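/- Let Ω be a planar Jordan domain and suppose that the surface Σ(Ω,t) (with gauge φ(t) = t) is λ-linearly locally connected for some λ > 1. Then the boundary ∂Ω satisfies the 2-point condition with constant 32λ²; in particular ∂Ω is a quasicircle. -/

import Mathlib

open Metric Set MeasureTheory

noncomputable section

/-- The Euclidean plane. -/
abbrev E2 : Type := EuclideanSpace ℝ (Fin 2)
/-- Euclidean three-space. -/
abbrev E3 : Type := EuclideanSpace ℝ (Fin 3)

/-- Build a point of ℝ³ from a planar point and a height. -/
def mk3 (x : E2) (z : ℝ) : E3 := (WithLp.equiv 2 (Fin 3 → ℝ)).symm ![x 0, x 1, z]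

/-- A Jordan curve: the image of the unit circle under a continuous injection
(equivalently, a topological embedding, by compactness of the circle). -/
def IsJordanCurve (Γ : Set E2) : Prop :=
  ∃ f : E2 → E2, ContinuousOn f (sphere 0 1) ∧ InjOn f (sphere 0 1) ∧ f '' (sphere 0 1) = Γ

/-- A Jordan domain: a bounded domain whose boundary is a Jordan curve. -/
def IsJordanDomain (Ω : Set E2) : Prop :=
  IsOpen Ω ∧ IsConnected Ω ∧ Bornology.IsBounded Ω ∧ IsJordanCurve (frontier Ω)

/-- The ε-level set γ_ε = {x ∈ Ω : dist(x,∂Ω) = ε}, with the convention γ₀ = ∂Ω. -/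
def levelSet (Ω : Set E2) (ε : ℝ) : Set E2 :=
  if ε = 0 then frontier Ω else {x ∈ Ω | infDist x (frontier Ω) = ε}

/-- The double-dome-like surface Σ(Ω,φ). -/
def domeSurface (Ω : Set E2) (φ : ℝ → ℝ) : Set E3 :=
  {p | ∃ x ∈ closure Ω, p = mk3 x (φ (infDist x (frontier Ω))) ∨
                        p = mk3 x (-φ (infDist x (frontier Ω)))}

/-- The class 𝓕 of gauges: homeomorphisms φ of [0,∞) onto [0,∞) with φ(0)=0,
liminf_{t→0} φ(t)/t > 0, and φ Lipschitz on [r,∞) for every r > 0. -/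
structure GaugeF (φ : ℝ → ℝ) : Prop where
  continuousOn : ContinuousOn φ (Ici 0)
  strictMonoOn : StrictMonoOn φ (Ici 0)
  surjOn : SurjOn φ (Ici 0) (Ici 0)
  map_zero : φ 0 = 0
  liminf_pos : ∃ m > (0:ℝ), ∀ᶠ t in nhdsWithin 0 (Ioi 0), m * t ≤ φ t
  lipschitzOn : ∀ r > (0:ℝ), ∃ L : NNReal, LipschitzOnWith L φ (Ici r)

/-- A subarc of Γ with endpoints x and y: a subset of Γ that is a simple arc from x to y. -/
def IsSubarc (Γ A : Set E2) (x y : E2) : Prop :=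
  A ⊆ Γ ∧ ∃ f : ℝ → E2, ContinuousOn f (Icc 0 1) ∧ InjOn f (Icc 0 1) ∧
    f 0 = x ∧ f 1 = y ∧ f '' (Icc 0 1) = A

/-- The 2-point condition with constant C: for any two points of Γ, some subarc joining
them (hence the one of smaller diameter) has diameter at most C·|x−y|. -/
def TwoPointCondition (Γ : Set E2) (C : ℝ) : Prop :=
  ∀ x ∈ Γ, ∀ y ∈ Γ, x ≠ y →
    ∃ A, IsSubarc Γ A x y ∧ Metric.diam A ≤ C * dist x y

/-- A c-chord-arc curve: a rectifiable Jordan curve such that for any two points, the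
shorter subarc joining them has length (1-dimensional Hausdorff measure) at most c·|x−y|. -/
def IsChordArc (Γ : Set E2) (c : ℝ) : Prop :=
  IsJordanCurve Γ ∧ μH[1] Γ < ⊤ ∧
  ∀ x ∈ Γ, ∀ y ∈ Γ, x ≠ y →
    ∃ A, IsSubarc Γ A x y ∧ μH[1] A ≤ ENNReal.ofReal (c * dist x y)

/-- The λ-LLC₁ condition. -/
def LLC1With {X : Type*} [MetricSpace X] (S : Set X) (lam : ℝ) : Prop :=
  ∀ x ∈ S, ∀ r > (0:ℝ), ∀ y₁ ∈ ball x r ∩ S, ∀ y₂ ∈ ball x r ∩ S,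
    ∃ E ⊆ ball x (lam * r) ∩ S, IsCompact E ∧ IsConnected E ∧ y₁ ∈ E ∧ y₂ ∈ E

/-- The λ-LLC₂ condition. -/
def LLC2With {X : Type*} [MetricSpace X] (S : Set X) (lam : ℝ) : Prop :=
  ∀ x ∈ S, ∀ r > (0:ℝ), ∀ y₁ ∈ S \ ball x r, ∀ y₂ ∈ S \ ball x r,
    ∃ E ⊆ S \ ball x (r / lam), IsCompact E ∧ IsConnected E ∧ y₁ ∈ E ∧ y₂ ∈ E

/-- λ-linear local connectivity. -/
def LLCWith {X : Type*} [MetricSpace X] (S : Set X) (lam : ℝ) : Prop :=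
  LLC1With S lam ∧ LLC2With S lam

/-- S (with the Euclidean metric of ℝ³) is quasisymmetric to the unit sphere S²:
there are a homeomorphism η of [0,∞) onto itself and an η-quasisymmetric
homeomorphism of S onto the unit sphere. -/
def QSEquivSphere (S : Set E3) : Prop :=
  ∃ η : ℝ → ℝ, (ContinuousOn η (Ici 0) ∧ StrictMonoOn η (Ici 0) ∧ SurjOn η (Ici 0) (Ici 0)) ∧
  ∃ f : S → (sphere (0:E3) 1 : Set E3), Function.Bijective f ∧
    ∀ (x a b : S) (t : ℝ), 0 < t → dist (x:E3) a ≤ t * dist (x:E3) b →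
      dist (f x : E3) (f a) ≤ η t * dist (f x : E3) (f b)

/-- The level chord-arc property. -/
def LevelChordArc (Ω : Set E2) : Prop :=
  ∃ ε₀ > (0:ℝ), ∃ c > (1:ℝ), ∀ ε, 0 ≤ ε → ε ≤ ε₀ → IsChordArc (levelSet Ω ε) c

/-- The level quasicircle property. -/
def LevelQuasicircle (Ω : Set E2) : Prop :=
  ∃ ε₀ > (0:ℝ), ∃ C > (1:ℝ), ∀ ε, 0 ≤ ε → ε ≤ ε₀ →
    IsJordanCurve (levelSet Ω ε) ∧ TwoPointCondition (levelSet Ω ε) C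

/-- `z ↦ z - w` has a continuous logarithm on `K`. -/
def HasLogOn (w : ℂ) (K : Set ℂ) : Prop :=
  ∃ g : ℂ → ℂ, ContinuousOn g K ∧ ∀ z ∈ K, Complex.exp (g z) = z - w

namespace HasLogOn

theorem mono {w : ℂ} {K L : Set ℂ} (h : HasLogOn w L) (hKL : K ⊆ L) : HasLogOn w K := by
  obtain ⟨g, hg, he⟩ := h
  exact ⟨g, hg.mono hKL, fun z hz => he z (hKL hz)⟩

theorem notMem {w : ℂ} {K : Set ℂ} (h : HasLogOn w K) : w ∉ K := by
  obtain ⟨g, -, he⟩ := h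
  intro hw
  exact Complex.exp_ne_zero _ ((he w hw).trans (sub_self w))

theorem exists_continuous {w : ℂ} {K : Set ℂ} (hK : IsClosed K) (h : HasLogOn w K) :
    ∃ g : ℂ → ℂ, Continuous g ∧ ∀ z ∈ K, Complex.exp (g z) = z - w := by
  obtain ⟨g, hg, he⟩ := h
  obtain ⟨G, hG⟩ := ContinuousMap.exists_restrict_eq hK
    (⟨fun z : K => g z, continuousOn_iff_continuous_domRestrict.mp hg⟩ : C(K, ℂ))
  refine ⟨G, G.continuous, fun z hz => ?_⟩
  have : G z = g z := DFunLike.congr_fun hG ⟨z, hz⟩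
  rw [this, he z hz]

end HasLogOn

/-- A nowhere vanishing continuous function on a contractible, locally path connected space has a
continuous logarithm. -/
theorem exists_continuous_exp_eq {X : Type*} [TopologicalSpace X] [LocallyPathConnectedSpace X]
    [SimplyConnectedSpace X] {h : X → ℂ} (hc : Continuous h) (h0 : ∀ x, h x ≠ 0) :
    ∃ g : X → ℂ, Continuous g ∧ ∀ x, Complex.exp (g x) = h x := by
  obtain ⟨x₀⟩ : Nonempty X := inferInstance
  obtain ⟨F, ⟨-, hF⟩, -⟩ := Complex.isCoveringMapOn_exp.existsUnique_continuousMap_lifts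
    ⟨h, hc⟩ (a₀ := x₀) (Complex.exp_log (h0 x₀)) h0
  exact ⟨F, F.continuous, fun x => congrFun hF x⟩

theorem HasLogOn.closure_of_frontier_subset {w : ℂ} {K U : Set ℂ} (hK : IsClosed K)
    (hU : frontier U ⊆ K) (hw : w ∉ U) (h : HasLogOn w K) : HasLogOn w (closure U) := by
  classical
  obtain ⟨g, hg, he⟩ := h.exists_continuous hK
  have hc : Continuous (U.piecewise (fun z => z - w) fun z => Complex.exp (g z)) :=
    Continuous.piecewise (fun a ha => (he a (hU ha)).symm) (by fun_prop) (by fun_prop)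
  obtain ⟨G, hG, hGe⟩ := exists_continuous_exp_eq hc fun z => by
    by_cases hz : z ∈ U
    · rw [piecewise_eq_of_mem _ _ _ hz]
      exact sub_ne_zero.mpr fun h => hw (h ▸ hz)
    · rw [piecewise_eq_of_notMem _ _ _ hz]
      exact Complex.exp_ne_zero _
  refine ⟨G, hG.continuousOn, fun z hz => ?_⟩
  rw [hGe]
  by_cases hzU : z ∈ U
  · rw [piecewise_eq_of_mem _ _ _ hzU]
  · rw [piecewise_eq_of_notMem _ _ _ hzU]
    exact he z (hU ⟨hz, fun h => hzU (interior_subset h)⟩)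

/-- On a preconnected set, two continuous logarithms of the same function differ by a constant. -/
theorem sub_eq_sub_of_exp_eq {X : Type*} [TopologicalSpace X] {S : Set X} (hS : IsPreconnected S)
    {g h : X → ℂ} (hg : ContinuousOn g S) (hh : ContinuousOn h S)
    (he : ∀ x ∈ S, Complex.exp (g x) = Complex.exp (h x)) {x y : X} (hx : x ∈ S) (hy : y ∈ S) :
    g x - h x = g y - h y := by
  have key : ∀ z ∈ S, ∃ n : ℤ, g z - h z = n • (2 * Real.pi * Complex.I) := fun z hz => by
    obtain ⟨n, hn⟩ := Complex.exp_eq_exp_iff_exists_int.mp (he z hz)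
    exact ⟨n, by rw [hn]; simp⟩
  have hd : DiscreteTopology (AddSubgroup.zmultiples (2 * Real.pi * Complex.I)) :=
    NormedSpace.discreteTopology_zmultiples _
  exact hS.constant_of_mapsTo (T := (AddSubgroup.zmultiples (2 * Real.pi * Complex.I) : Set ℂ)) ⟨hd⟩
    (hg.sub hh) (fun z hz => by
      obtain ⟨n, hn⟩ := key z hz
      exact ⟨n, hn.symm⟩) hx hy

theorem not_hasLogOn_sphere {w : ℂ} {R : ℝ} (hR : 0 < R) : ¬ HasLogOn w (sphere w R) := by
  rintro ⟨g, hg, he⟩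
  let c : ℝ → ℂ := fun t => circleMap w R t
  have hc : ∀ t, c t ∈ sphere w R := fun t => circleMap_mem_sphere w hR.le t
  have h := sub_eq_sub_of_exp_eq (S := univ) (g := fun t : ℝ => g (c t))
    (h := fun t : ℝ => Complex.log R + t * Complex.I) isPreconnected_univ
    (hg.comp_continuous (continuous_circleMap w R) hc).continuousOn
    (by fun_prop)
    (fun t _ => by
      rw [he _ (hc t), Complex.exp_add, Complex.exp_log (by exact_mod_cast hR.ne')]
      simp [c, circleMap])
    (mem_univ (0 : ℝ)) (mem_univ (2 * Real.pi))
  have h2 : c (2 * Real.pi) = c 0 := by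
    simpa using periodic_circleMap w R 0
  simp only [h2] at h
  have := Real.pi_ne_zero
  simp_all

theorem not_hasLogOn_of_isBounded {u : ℂ} {O K : Set ℂ} (hO : Bornology.IsBounded O)
    (hK : IsClosed K) (hOK : frontier O ⊆ K) (hu : u ∈ O) : ¬ HasLogOn u K := by
  intro h
  obtain ⟨R, hR0, hR⟩ : ∃ R > 0, O ⊆ ball u R := by
    obtain ⟨R, hR⟩ := hO.subset_ball u
    exact ⟨max R 1, by positivity, hR.trans (ball_subset_ball (le_max_left _ _))⟩
  refine not_hasLogOn_sphere hR0 ((h.closure_of_frontier_subset (U := Oᶜ) hK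
    (by rwa [frontier_compl]) (by simpa using hu)).mono fun z hz => subset_closure fun hzO => ?_)
  have := hR hzO
  rw [mem_sphere] at hz
  rw [mem_ball] at this
  linarith

theorem HasLogOn.of_dist_lt {w v : ℂ} {K : Set ℂ} (h : HasLogOn w K)
    (hd : ∀ z ∈ K, dist v w < dist z w) : HasLogOn v K := by
  obtain ⟨g, hg, he⟩ := h
  have hne : ∀ z ∈ K, z - w ≠ 0 := fun z hz => by
    rw [← he z hz]; exact Complex.exp_ne_zero _
  have hs : ∀ z ∈ K, 1 + (w - v) / (z - w) ∈ Complex.slitPlane := fun z hz => by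
    apply Complex.mem_slitPlane_of_norm_lt_one
    rw [norm_div, div_lt_one (norm_pos_iff.mpr (hne z hz)), ← dist_eq_norm, ← dist_eq_norm,
      dist_comm]
    exact hd z hz
  refine ⟨fun z => g z + Complex.log (1 + (w - v) / (z - w)), hg.add (ContinuousOn.clog ?_ hs),
    fun z hz => ?_⟩
  · exact continuousOn_const.add (continuousOn_const.div (by fun_prop) hne)
  · rw [Complex.exp_add, he z hz, Complex.exp_log (Complex.slitPlane_ne_zero (hs z hz))]
    have := hne z hz
    field_simp
    ring

theorem hasLogOn_of_norm_lt {w : ℂ} {K : Set ℂ} (h : ∀ z ∈ K, ‖z‖ < ‖w‖) : HasLogOn w K := by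
  rcases K.eq_empty_or_nonempty with rfl | ⟨z₀, hz₀⟩
  · exact ⟨id, by simp, by simp⟩
  have hw : w ≠ 0 := norm_pos_iff.mp ((norm_nonneg _).trans_lt (h z₀ hz₀))
  have hs : ∀ z ∈ K, 1 + -z / w ∈ Complex.slitPlane := fun z hz => by
    apply Complex.mem_slitPlane_of_norm_lt_one
    rw [norm_div, div_lt_one (norm_pos_iff.mpr hw), norm_neg]
    exact h z hz
  refine ⟨fun z => Complex.log (-w) + Complex.log (1 + -z / w),
    continuousOn_const.add (ContinuousOn.clog (by fun_prop) hs), fun z hz => ?_⟩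
  rw [Complex.exp_add, Complex.exp_log (neg_ne_zero.mpr hw),
    Complex.exp_log (Complex.slitPlane_ne_zero (hs z hz))]
  field_simp
  ring

theorem exists_ball_hasLogOn_iff {w : ℂ} {K : Set ℂ} (hK : IsClosed K) (hw : w ∉ K) :
    ∃ ε > 0, ∀ v ∈ ball w ε, v ∉ K ∧ (HasLogOn v K ↔ HasLogOn w K) := by
  obtain ⟨ε, hε, hb⟩ := Metric.isOpen_iff.mp hK.isOpen_compl w hw
  have hd : ∀ z ∈ K, ε ≤ dist z w := fun z hz => by
    by_contra! h
    exact hb h hz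
  refine ⟨ε / 2, by positivity, fun v hv => ?_⟩
  rw [mem_ball] at hv
  refine ⟨fun h => by linarith [hd v h], fun h => h.of_dist_lt fun z hz => ?_,
    fun h => h.of_dist_lt fun z hz => ?_⟩
  · have := dist_triangle z v w
    rw [dist_comm w v]
    linarith [hd z hz]
  · linarith [hd z hz]

theorem isOpen_setOf_hasLogOn {K : Set ℂ} (hK : IsClosed K) : IsOpen {w | HasLogOn w K} := by
  refine Metric.isOpen_iff.mpr fun w hw => ?_
  obtain ⟨ε, hε, h⟩ := exists_ball_hasLogOn_iff hK (HasLogOn.notMem hw)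
  exact ⟨ε, hε, fun v hv => (h v hv).2.mpr hw⟩

theorem isOpen_setOf_not_hasLogOn {K : Set ℂ} (hK : IsClosed K) :
    IsOpen {w | w ∉ K ∧ ¬ HasLogOn w K} := by
  refine Metric.isOpen_iff.mpr fun w hw => ?_
  obtain ⟨ε, hε, h⟩ := exists_ball_hasLogOn_iff hK hw.1
  exact ⟨ε, hε, fun v hv => ⟨(h v hv).1, fun hv' => hw.2 ((h v hv).2.mp hv')⟩⟩

/-- Janiszewski's theorem. -/
theorem HasLogOn.union {w : ℂ} {K L : Set ℂ} (hK : IsClosed K) (hL : IsClosed L)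
    (hKL : IsConnected (K ∩ L)) (h : HasLogOn w K) (h' : HasLogOn w L) : HasLogOn w (K ∪ L) := by
  classical
  obtain ⟨g, hg, he⟩ := h
  obtain ⟨g', hg', he'⟩ := h'
  obtain ⟨z₀, hz₀⟩ := hKL.nonempty
  have hc : ∀ z ∈ K ∩ L, g z - g' z = g z₀ - g' z₀ := fun z hz =>
    sub_eq_sub_of_exp_eq hKL.isPreconnected (hg.mono inter_subset_left)
      (hg'.mono inter_subset_right) (fun x hx => by rw [he x hx.1, he' x hx.2]) hz hz₀
  have hexp : Complex.exp (g z₀ - g' z₀) = 1 := by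
    rw [Complex.exp_sub, he z₀ hz₀.1, he' z₀ hz₀.2, div_self]
    rw [← he z₀ hz₀.1]
    exact Complex.exp_ne_zero _
  have hL' : EqOn (K.piecewise g fun z => g' z + (g z₀ - g' z₀)) (fun z => g' z + (g z₀ - g' z₀))
      L := fun z hz => by
    by_cases hzK : z ∈ K
    · rw [piecewise_eq_of_mem _ _ _ hzK, ← hc z ⟨hzK, hz⟩]
      ring
    · rw [piecewise_eq_of_notMem _ _ _ hzK]
  refine ⟨K.piecewise g fun z => g' z + (g z₀ - g' z₀), ?_, ?_⟩
  · exact ContinuousOn.union_of_isClosed (hg.congr (piecewise_eqOn _ _ _))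
      ((hg'.add continuousOn_const).congr hL') hK hL
  · rintro z (hz | hz)
    · rw [piecewise_eq_of_mem _ _ _ hz, he z hz]
    · rw [hL' hz, Complex.exp_add, hexp, mul_one, he' z hz]

/-- An arc does not separate the plane. -/
theorem hasLogOn_arc {G : ℝ → ℂ} (hG : Continuous G) {a b : ℝ} (hab : a ≤ b)
    (hinj : InjOn G (Icc a b)) {u : ℂ} (hu : u ∉ G '' Icc a b) : HasLogOn u (G '' Icc a b) := by
  obtain ⟨l, hl, hle⟩ := exists_continuous_exp_eq
    (h := fun t : ℝ => G (projIcc a b hab t) - u)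
    ((hG.comp (continuous_subtype_val.comp continuous_projIcc)).sub continuous_const)
    fun t => sub_ne_zero.mpr fun h => hu ⟨_, (projIcc a b hab t).2, h⟩
  have hemb : Topology.IsClosedEmbedding fun t : Icc a b => G t :=
    (hG.comp continuous_subtype_val).isClosedEmbedding (injOn_iff_injective.mp hinj)
  obtain ⟨g, hg⟩ := ContinuousMap.exists_extension hemb
    (⟨fun t : Icc a b => l t, hl.comp continuous_subtype_val⟩ : C(Icc a b, ℂ))
  refine ⟨g, g.continuous.continuousOn, ?_⟩
  rintro _ ⟨t, ht, rfl⟩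
  have h1 : g (G t) = l t := DFunLike.congr_fun hg ⟨t, ht⟩
  rw [h1, hle, projIcc_of_mem hab ht]

/-- `G` is a `2π`-periodic parametrization of the Jordan curve `Γ`. -/
structure IsJordanParam {X : Type*} [TopologicalSpace X] (G : ℝ → X) (Γ : Set X) : Prop where
  continuous : Continuous G
  periodic : Function.Periodic G (2 * Real.pi)
  eq_of_abs_lt : ∀ s t, |s - t| < 2 * Real.pi → G s = G t → s = t
  range_eq : range G = Γ

namespace IsJordanParam

variable {X : Type*} [TopologicalSpace X] {G : ℝ → X} {Γ : Set X}

theorem mem (h : IsJordanParam G Γ) (t : ℝ) : G t ∈ Γ := h.range_eq ▸ mem_range_self t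

theorem exists_mem_Ico (h : IsJordanParam G Γ) {z : X} (hz : z ∈ Γ) (a : ℝ) :
    ∃ t ∈ Ico a (a + 2 * Real.pi), G t = z := by
  rw [← h.range_eq] at hz
  obtain ⟨s, rfl⟩ := hz
  obtain ⟨t, ht, hst⟩ := h.periodic.exists_mem_Ico Real.two_pi_pos s a
  exact ⟨t, ht, hst.symm⟩

theorem injOn_Icc (h : IsJordanParam G Γ) {a b : ℝ} (hab : b < a + 2 * Real.pi) :
    InjOn G (Icc a b) := fun s hs t ht hst =>
  h.eq_of_abs_lt s t (abs_lt.mpr ⟨by linarith [hs.1, ht.2], by linarith [hs.2, ht.1]⟩) hst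

theorem subset_union (h : IsJordanParam G Γ) (a b : ℝ) :
    Γ ⊆ G '' Icc a b ∪ G '' Icc b (a + 2 * Real.pi) := by
  intro z hz
  obtain ⟨t, ht, rfl⟩ := h.exists_mem_Ico hz a
  rcases le_total t b with htb | htb
  · exact Or.inl ⟨t, ⟨ht.1, htb⟩, rfl⟩
  · exact Or.inr ⟨t, ⟨htb, ht.2.le⟩, rfl⟩

theorem inter_subset (h : IsJordanParam G Γ) (a b : ℝ) :
    G '' Icc a b ∩ G '' Icc b (a + 2 * Real.pi) ⊆ {G a, G b} := by
  rintro _ ⟨⟨s, hs, rfl⟩, t, ht, hst⟩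
  rcases hs.1.eq_or_lt with rfl | has
  · exact Or.inl rfl
  · have := h.eq_of_abs_lt t s
      (abs_lt.mpr ⟨by linarith [hs.2, ht.1, Real.pi_pos], by linarith [ht.2]⟩) hst
    subst this
    exact Or.inr (congrArg G (le_antisymm hs.2 ht.1))

theorem comp {Y : Type*} [TopologicalSpace Y] (h : IsJordanParam G Γ) (e : X ≃ₜ Y) :
    IsJordanParam (e ∘ G) (e '' Γ) where
  continuous := e.continuous.comp h.continuous
  periodic t := congrArg e (h.periodic t)
  eq_of_abs_lt s t hst heq := h.eq_of_abs_lt s t hst (e.injective heq)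
  range_eq := by rw [range_comp, h.range_eq]

end IsJordanParam

section Separation

variable {Ω : Set ℂ} {G : ℝ → ℂ}

/-- Every boundary point of a Jordan domain is accessible from the exterior. -/
theorem exists_mem_ball_hasLogOn (hO : IsOpen Ω) (hb : Bornology.IsBounded Ω)
    (hne : Ω.Nonempty) (hG : IsJordanParam G (frontier Ω)) {a : ℂ} (ha : a ∈ frontier Ω)
    {ε : ℝ} (hε : 0 < ε) : ∃ v ∈ ball a ε, HasLogOn v (frontier Ω) := by
  by_contra! hcon
  obtain ⟨u, hu⟩ := hne
  have huΓ : u ∉ frontier Ω := fun h => h.2 (by rwa [hO.interior_eq])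
  have huL : ¬ HasLogOn u (frontier Ω) :=
    not_hasLogOn_of_isBounded hb isClosed_frontier subset_rfl hu
  obtain ⟨R, hR⟩ := (hb.closure.subset frontier_subset_closure).subset_closedBall (0 : ℂ)
  set L : Set ℂ := {w | HasLogOn w (frontier Ω)}
  have disj : ∀ U : Set ℂ, IsOpen U → (∀ w ∈ U, w ∉ L) → ∀ w ∈ U, w ∉ closure L :=
    fun U hU h w hw hwL => by
      obtain ⟨z, hz, hzL⟩ := mem_closure_iff.mp hwL U hU hw
      exact h z hz hzL
  have hN := disj _ (isOpen_setOf_not_hasLogOn (isClosed_frontier (s := Ω))) fun w hw => hw.2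
  have hD := disj (ball a ε) isOpen_ball hcon
  have hfr : frontier (closure L)ᶜ ⊆ frontier Ω \ ball a ε := by
    rw [frontier_compl]
    intro z hz
    have hz' := frontier_closure_subset hz
    refine ⟨?_, fun h => hD z h hz'.1⟩
    by_contra hzΓ
    refine hN z ⟨hzΓ, fun h => hz'.2 ?_⟩ hz'.1
    rwa [(isOpen_setOf_hasLogOn isClosed_frontier).interior_eq]
  have hbd : Bornology.IsBounded (closure L)ᶜ := by
    refine (isBounded_closedBall (x := (0 : ℂ)) (r := R)).subset fun w hw => ?_
    by_contra hwR
    refine hw (subset_closure (hasLogOn_of_norm_lt fun z hz => ?_))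
    have h1 := hR hz
    rw [mem_closedBall_zero_iff] at h1 hwR
    linarith
  obtain ⟨t₀, -, rfl⟩ := hG.exists_mem_Ico ha 0
  obtain ⟨δ, hδ, hball⟩ := Metric.continuousAt_iff.mp hG.continuous.continuousAt ε hε
  obtain ⟨η, hη, hηδ, hηπ⟩ : ∃ η > 0, η ≤ δ ∧ η ≤ Real.pi :=
    ⟨min δ Real.pi, lt_min hδ Real.pi_pos, min_le_left _ _, min_le_right _ _⟩
  have harc : frontier Ω \ ball (G t₀) ε ⊆ G '' Icc (t₀ + η) (t₀ + 2 * Real.pi - η) := by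
    rintro z ⟨hz, hzb⟩
    obtain ⟨t, ht, rfl⟩ := hG.exists_mem_Ico hz t₀
    refine ⟨t, ⟨?_, ?_⟩, rfl⟩ <;> by_contra! hlt <;> apply hzb
    · exact hball (by rw [Real.dist_eq, abs_lt]; constructor <;> linarith [ht.1])
    · rw [mem_ball, ← hG.periodic.sub_eq]
      exact hball (by rw [Real.dist_eq, abs_lt]; constructor <;> linarith [ht.2])
  refine not_hasLogOn_of_isBounded hbd (isCompact_Icc.image hG.continuous).isClosed
    (hfr.trans harc) (hN u ⟨huΓ, huL⟩) (hasLogOn_arc hG.continuous (by linarith)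
    (hG.injOn_Icc (by linarith)) fun h => huΓ ?_)
  obtain ⟨t, -, rfl⟩ := h
  exact hG.mem t

theorem hasLogOn_of_mem_frontier (hO : IsOpen Ω) (hb : Bornology.IsBounded Ω)
    (hne : Ω.Nonempty) (hG : IsJordanParam G (frontier Ω)) {a : ℂ} (ha : a ∈ frontier Ω)
    {K : Set ℂ} (hK : IsClosed K) (hKΩ : K ⊆ closure Ω) (haK : a ∉ K) : HasLogOn a K := by
  obtain ⟨ε, hε, h⟩ := exists_ball_hasLogOn_iff hK haK
  obtain ⟨v, hv, hvL⟩ := exists_mem_ball_hasLogOn hO hb hne hG ha hε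
  have hvΩ : v ∉ Ω := fun hv' => not_hasLogOn_of_isBounded hb isClosed_frontier subset_rfl hv' hvL
  exact (h v hv).2.mp
    ((hvL.closure_of_frontier_subset isClosed_frontier subset_rfl hvΩ).mono hKΩ)

/-- In the closure of a Jordan domain, two continua joining two pairs of boundary points which
separate each other on the boundary must meet. -/
theorem inter_nonempty_of_separated (hO : IsOpen Ω) (hb : Bornology.IsBounded Ω)
    (hG : IsJordanParam G (frontier Ω)) {E F : Set ℂ} (hE : IsClosed E) (hEc : IsConnected E)
    (hEΩ : E ⊆ closure Ω) (hFc : IsPreconnected F) (hFΩ : F ⊆ closure Ω)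
    {α β s t : ℝ} (hαs : α < s) (hsβ : s < β) (hβt : β < t) (htα : t < α + 2 * Real.pi)
    (hα : G α ∈ E) (hβ : G β ∈ E) (hs : G s ∈ F) (ht : G t ∈ F) : (E ∩ F).Nonempty := by
  by_contra hEF
  have hdis : ∀ z ∈ F, z ∉ E := fun z hzF hzE => hEF ⟨z, hzE, hzF⟩
  have hne : Ω.Nonempty := by
    rcases Ω.eq_empty_or_nonempty with rfl | h
    · simpa using hG.mem 0
    · exact h
  set A := G '' Icc α β
  set B := G '' Icc β (α + 2 * Real.pi)
  have hAcl : IsClosed A := (isCompact_Icc.image hG.continuous).isClosed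
  have hBcl : IsClosed B := (isCompact_Icc.image hG.continuous).isClosed
  have hAΓ : A ⊆ frontier Ω := by rintro _ ⟨r, -, rfl⟩; exact hG.mem r
  have hBΓ : B ⊆ frontier Ω := by rintro _ ⟨r, -, rfl⟩; exact hG.mem r
  have hAB : A ∩ B ⊆ E := (hG.inter_subset α β).trans
    (by rintro z (rfl | rfl) <;> assumption)
  have hsA : G s ∈ A := ⟨s, ⟨hαs.le, hsβ.le⟩, rfl⟩
  have htB : G t ∈ B := ⟨t, ⟨hβt.le, htα.le⟩, rfl⟩
  have hEA : IsClosed (E ∪ A) := hE.union hAcl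
  have hEB : IsClosed (E ∪ B) := hE.union hBcl
  have hlogA : ∀ z ∈ F, z ∈ B → HasLogOn z (E ∪ A) := fun z hzF hzB =>
    hasLogOn_of_mem_frontier hO hb hne hG (hBΓ hzB) hEA
      (union_subset hEΩ (hAΓ.trans frontier_subset_closure))
      (by rintro (h | h); exacts [hdis z hzF h, hdis z hzF (hAB ⟨h, hzB⟩)])
  have hlogB : ∀ z ∈ F, z ∈ A → HasLogOn z (E ∪ B) := fun z hzF hzA =>
    hasLogOn_of_mem_frontier hO hb hne hG (hAΓ hzA) hEB
      (union_subset hEΩ (hBΓ.trans frontier_subset_closure))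
      (by rintro (h | h); exacts [hdis z hzF h, hdis z hzF (hAB ⟨hzA, h⟩)])
  have hinter : ∀ z ∈ F, HasLogOn z (E ∪ B) → ¬ HasLogOn z (E ∪ A) := fun z hzF hzB hzA => by
    have hEAB : (E ∪ A) ∩ (E ∪ B) = E := by
      rw [← union_inter_distrib_left, union_eq_left.mpr hAB]
    have hΓ : HasLogOn z (frontier Ω) := (hzA.union hEA hEB (hEAB.symm ▸ hEc) hzB).mono
      ((hG.subset_union α β).trans (union_subset_union subset_union_right subset_union_right))
    refine not_hasLogOn_of_isBounded hb isClosed_frontier subset_rfl ?_ hΓ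
    by_contra hzΩ
    exact hΓ.notMem ⟨hFΩ hzF, by rwa [hO.interior_eq]⟩
  obtain ⟨z, hzF, hzP, hzQ⟩ := hFc {w | HasLogOn w (E ∪ B)}
    ({w | w ∉ E ∪ B ∧ ¬ HasLogOn w (E ∪ B)} ∪ {w | HasLogOn w (E ∪ A)})
    (isOpen_setOf_hasLogOn hEB)
    ((isOpen_setOf_not_hasLogOn hEB).union (isOpen_setOf_hasLogOn hEA))
    (fun z hzF => by
      by_cases hzB : z ∈ B
      · exact Or.inr (Or.inr (hlogA z hzF hzB))
      · by_cases h : HasLogOn z (E ∪ B)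
        · exact Or.inl h
        · exact Or.inr (Or.inl ⟨by rintro (h' | h'); exacts [hdis z hzF h', hzB h'], h⟩))
    ⟨G s, hs, hlogB _ hs hsA⟩ ⟨G t, ht, Or.inr (hlogA _ ht htB)⟩
  rcases hzQ with hzQ | hzQ
  exacts [hzQ.2 hzP, hinter z hzF hzP hzQ]

end Separation

theorem IsJordanCurve.exists_isJordanParam {Γ : Set E2} (h : IsJordanCurve Γ) :
    ∃ G : ℝ → E2, IsJordanParam G Γ := by
  obtain ⟨f, hf, hinj, rfl⟩ := h
  let e : E2 ≃ₗᵢ[ℝ] ℂ := Complex.orthonormalBasisOneI.repr.symm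
  have hmem : ∀ t : ℝ, e.symm (Circle.exp t) ∈ sphere (0 : E2) 1 := fun t => by
    rw [mem_sphere_zero_iff_norm, e.symm.norm_map, Circle.norm_coe]
  refine ⟨fun t => f (e.symm (Circle.exp t)), hf.comp_continuous ?_ hmem, fun t => ?_,
    fun s t hst heq => ?_, ?_⟩
  · exact e.symm.continuous.comp (continuous_subtype_val.comp Circle.exp.continuous)
  · simp only [Circle.periodic_exp t]
  · have h1 := Circle.ext (e.symm.injective (hinj (hmem s) (hmem t) heq))
    obtain ⟨n, rfl⟩ := Circle.exp_eq_exp.mp h1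
    rw [add_sub_cancel_left, abs_mul, abs_of_pos Real.two_pi_pos,
      mul_lt_iff_lt_one_left Real.two_pi_pos] at hst
    have hn : n = 0 := Int.abs_lt_one_iff.mp (by exact_mod_cast hst)
    simp [hn]
  · refine Subset.antisymm (range_subset_iff.mpr fun t => mem_image_of_mem f (hmem t)) ?_
    rintro _ ⟨p, hp, rfl⟩
    have hp' : ‖e p‖ = 1 := by rwa [e.norm_map, ← mem_sphere_zero_iff_norm]
    refine ⟨Complex.arg (e p), ?_⟩
    have : ((Circle.exp (Complex.arg (e p)) : Circle) : ℂ) = e p := by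
      rw [Circle.coe_exp]
      simpa [hp'] using Complex.norm_mul_exp_arg_mul_I (e p)
    simp only [this, e.symm_apply_apply]

theorem IsSubarc.symm {Γ A : Set E2} {x y : E2} (h : IsSubarc Γ A x y) : IsSubarc Γ A y x := by
  obtain ⟨hA, f, hf, hinj, h0, h1, him⟩ := h
  have hmaps : MapsTo (fun t : ℝ => 1 - t) (Icc 0 1) (Icc 0 1) := fun t ht =>
    ⟨by linarith [ht.2], by linarith [ht.1]⟩
  refine ⟨hA, fun t => f (1 - t), hf.comp (by fun_prop) hmaps,
    hinj.comp (sub_right_injective.injOn) hmaps, by simpa, by simpa, ?_⟩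
  rw [← him]
  refine Subset.antisymm ?_ ?_
  · rintro _ ⟨t, ht, rfl⟩
    exact ⟨1 - t, hmaps ht, rfl⟩
  · rintro _ ⟨t, ht, rfl⟩
    exact ⟨1 - t, hmaps ht, by simp⟩

theorem IsJordanParam.isSubarc {G : ℝ → E2} {Γ : Set E2} (h : IsJordanParam G Γ) {a b : ℝ}
    (hab : a < b) (hba : b < a + 2 * Real.pi) : IsSubarc Γ (G '' Icc a b) (G a) (G b) := by
  have himg : (fun t : ℝ => (b - a) * t + a) '' Icc 0 1 = Icc a b := by
    rw [image_affine_Icc' (sub_pos.mpr hab)]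
    simp
  refine ⟨by rintro _ ⟨t, -, rfl⟩; exact h.mem t, fun t => G ((b - a) * t + a),
    (h.continuous.comp (by fun_prop)).continuousOn, ?_, by simp, by simp, ?_⟩
  · refine (h.injOn_Icc hba).comp (fun s _ t _ hst => ?_) (himg ▸ mapsTo_image _ _)
    exact mul_left_cancel₀ (sub_pos.mpr hab).ne' (add_right_cancel hst)
  · rw [← himg, image_image]

/-- The planar version of `inter_nonempty_of_separated`. -/
theorem IsJordanParam.inter_nonempty_of_separated {Ω : Set E2} {G : ℝ → E2} (hO : IsOpen Ω)
    (hb : Bornology.IsBounded Ω) (hG : IsJordanParam G (frontier Ω)) {E F : Set E2}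
    (hE : IsClosed E) (hEc : IsConnected E) (hEΩ : E ⊆ closure Ω)
    (hFc : IsPreconnected F) (hFΩ : F ⊆ closure Ω)
    {α β s t : ℝ} (hαs : α < s) (hsβ : s < β) (hβt : β < t) (htα : t < α + 2 * Real.pi)
    (hα : G α ∈ E) (hβ : G β ∈ E) (hs : G s ∈ F) (ht : G t ∈ F) : (E ∩ F).Nonempty := by
  let e : E2 ≃ₗᵢ[ℝ] ℂ := Complex.orthonormalBasisOneI.repr.symm
  let e' : E2 ≃ₜ ℂ := e.toHomeomorph
  have hG' : IsJordanParam (e' ∘ G) (frontier (e' '' Ω)) := by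
    rw [← e'.image_frontier]
    exact hG.comp e'
  have h := _root_.inter_nonempty_of_separated (E := e' '' E) (F := e' '' F)
    (e'.isOpenMap _ hO) (e.lipschitz.isBounded_image hb) hG'
    (e'.isClosedMap _ hE) (hEc.image _ e'.continuous.continuousOn)
    (by rw [← e'.image_closure]; exact image_mono hEΩ)
    (hFc.image _ e'.continuous.continuousOn)
    (by rw [← e'.image_closure]; exact image_mono hFΩ) hαs hsβ hβt htα
    (mem_image_of_mem _ hα) (mem_image_of_mem _ hβ) (mem_image_of_mem _ hs)
    (mem_image_of_mem _ ht)
  rwa [← image_inter e'.injective, image_nonempty] at h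

/-- The vertical projection of space to the plane. -/
def proj2 (p : E3) : E2 := !₂[p 0, p 1]

theorem continuous_proj2 : Continuous proj2 := by
  unfold proj2
  fun_prop

theorem proj2_mk3 (x : E2) (z : ℝ) : proj2 (mk3 x z) = x := by
  ext i
  fin_cases i <;> simp [proj2, mk3]

theorem dist_mk3_sq (x y : E2) (z w : ℝ) :
    dist (mk3 x z) (mk3 y w) ^ 2 = dist x y ^ 2 + (z - w) ^ 2 := by
  rw [EuclideanSpace.dist_sq_eq, EuclideanSpace.dist_sq_eq, Fin.sum_univ_three, Fin.sum_univ_two]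
  simp [mk3, Real.dist_eq, sq_abs]

theorem dist_mk3_zero (x y : E2) : dist (mk3 x 0) (mk3 y 0) = dist x y := by
  have h := dist_mk3_sq x y 0 0
  rw [sub_self, zero_pow two_ne_zero, add_zero] at h
  exact (pow_left_inj₀ dist_nonneg dist_nonneg two_ne_zero).mp h

theorem mk3_zero_mem_domeSurface {Ω : Set E2} {x : E2} (hx : x ∈ frontier Ω) :
    mk3 x 0 ∈ domeSurface Ω fun t => t :=
  ⟨x, frontier_subset_closure hx, Or.inl (by rw [infDist_zero_of_mem hx])⟩

theorem proj2_mem_closure {Ω : Set E2} {φ : ℝ → ℝ} {p : E3} (hp : p ∈ domeSurface Ω φ) :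
    proj2 p ∈ closure Ω := by
  obtain ⟨w, hw, rfl | rfl⟩ := hp <;> rwa [proj2_mk3]

theorem dist_proj2_le {Ω : Set E2} {φ : ℝ → ℝ} {p : E3} (hp : p ∈ domeSurface Ω φ) (x : E2) :
    dist (proj2 p) x ≤ dist p (mk3 x 0) := by
  obtain ⟨w, -, rfl | rfl⟩ := hp <;> rw [proj2_mk3] <;>
    refine abs_le_of_sq_le_sq' ?_ dist_nonneg |>.2 <;> rw [dist_mk3_sq] <;> nlinarith

theorem dist_le_two_mul_dist_proj2 {Ω : Set E2} {p : E3} (hp : p ∈ domeSurface Ω fun t => t)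
    {x : E2} (hx : x ∈ frontier Ω) : dist p (mk3 x 0) ≤ 2 * dist (proj2 p) x := by
  obtain ⟨w, hw, hp⟩ := hp
  have hd : infDist w (frontier Ω) ≤ dist w x := infDist_le_dist_of_mem hx
  have hd0 : 0 ≤ infDist w (frontier Ω) := infDist_nonneg
  rcases hp with rfl | rfl <;> rw [proj2_mk3] <;>
    refine abs_le_of_sq_le_sq' ?_ (by positivity) |>.2 <;> rw [dist_mk3_sq] <;> nlinarith

theorem exists_lt_dist_of_lt_diam {X : Type*} [PseudoMetricSpace X] {S : Set X} {r : ℝ}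
    (hr : 0 ≤ r) (h : 2 * r < Metric.diam S) (x : X) : ∃ z ∈ S, r < dist z x := by
  by_contra! hcon
  exact h.not_ge ((Metric.diam_mono hcon isBounded_closedBall).trans (diam_closedBall hr))

/-- If Σ(Ω,t) is λ-LLC then ∂Ω satisfies the 2-point condition with constant 32λ²
(hence is a quasicircle). -/
theorem stmt3 (Ω : Set E2) (hΩ : IsJordanDomain Ω) (lam : ℝ) (hlam : 1 < lam)
    (hLLC : LLCWith (domeSurface Ω (fun t => t)) lam) :
    TwoPointCondition (frontier Ω) (32 * lam ^ 2) := by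
  obtain ⟨hO, -, hb, hJ⟩ := hΩ
  obtain ⟨G, hG⟩ := hJ.exists_isJordanParam
  intro x hx y hy hxy
  obtain ⟨α, -, rfl⟩ := hG.exists_mem_Ico hx 0
  obtain ⟨β, hβ, rfl⟩ := hG.exists_mem_Ico hy α
  have hαβ : α < β := hβ.1.lt_of_ne fun h => hxy (congrArg G h)
  have hA := hG.isSubarc hαβ hβ.2
  have hB := (hG.isSubarc hβ.2 (by linarith)).symm
  rw [hG.periodic α] at hB
  by_contra! hcon
  have hd := dist_pos.mpr hxy
  set d := dist (G α) (G β)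
  have hlam2 : lam < lam ^ 2 := by nlinarith
  have hr : 0 < 16 * lam ^ 2 * d := by positivity
  have hdr : d < 16 * lam ^ 2 * d := by nlinarith
  obtain ⟨_, ⟨s, hs, rfl⟩, hsd⟩ := exists_lt_dist_of_lt_diam hr.le
    ((by ring : _ = _).trans_lt (hcon _ hA)) (G α)
  obtain ⟨_, ⟨t, ht, rfl⟩, htd⟩ := exists_lt_dist_of_lt_diam hr.le
    ((by ring : _ = _).trans_lt (hcon _ hB)) (G α)
  have hβr : ¬ 16 * lam ^ 2 * d < dist (G β) (G α) := by
    rw [dist_comm]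
    exact hdr.le.not_gt
  have hαr : ¬ 16 * lam ^ 2 * d < dist (G α) (G α) := by
    rw [dist_self]
    exact hr.le.not_gt
  have hαs : α < s := hs.1.lt_of_ne (by rintro rfl; exact hαr hsd)
  have hsβ : s < β := hs.2.lt_of_ne (by rintro rfl; exact hβr hsd)
  have hβt : β < t := ht.1.lt_of_ne (by rintro rfl; exact hβr htd)
  have htα : t < α + 2 * Real.pi :=
    ht.2.lt_of_ne (by rintro rfl; rw [hG.periodic α] at htd; exact hαr htd)
  have hmem : ∀ r : ℝ, mk3 (G r) 0 ∈ domeSurface Ω fun t => t := fun r =>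
    mk3_zero_mem_domeSurface (hG.mem r)
  obtain ⟨E, hEs, hEk, hEc, hαE, hβE⟩ := hLLC.1 _ (hmem α) (2 * d) (by positivity)
    _ ⟨mem_ball_self (by positivity), hmem α⟩
    _ ⟨by rw [mem_ball, dist_mk3_zero, dist_comm]; linarith, hmem β⟩
  obtain ⟨F, hFs, -, hFc, hsF, htF⟩ := hLLC.2 _ (hmem α) _ hr
    _ ⟨hmem s, by rw [mem_ball, dist_mk3_zero]; exact hsd.not_gt⟩
    _ ⟨hmem t, by rw [mem_ball, dist_mk3_zero]; exact htd.not_gt⟩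
  have himg : ∀ {S : Set E3} {r : ℝ}, mk3 (G r) 0 ∈ S → G r ∈ proj2 '' S := fun h =>
    ⟨_, h, proj2_mk3 _ _⟩
  obtain ⟨_, ⟨p, hp, rfl⟩, q, hq, hqp⟩ := hG.inter_nonempty_of_separated hO hb
    (hEk.image continuous_proj2).isClosed (hEc.image _ continuous_proj2.continuousOn)
    (image_subset_iff.mpr fun p hp => proj2_mem_closure (hEs hp).2)
    (hFc.image _ continuous_proj2.continuousOn).isPreconnected
    (image_subset_iff.mpr fun p hp => proj2_mem_closure (hFs hp).1)
    hαs hsβ hβt htα (himg hαE) (himg hβE) (himg hsF) (himg htF)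
  have h1 := dist_proj2_le (hEs hp).2 (G α)
  have h2 := dist_le_two_mul_dist_proj2 (hFs hq).1 hx
  have h3 := mem_ball.mp (hEs hp).1
  have h4 : 16 * lam ^ 2 * d / lam ≤ dist q (mk3 (G α) 0) := by
    simpa using (hFs hq).2
  rw [hqp] at h2
  have h5 : 16 * lam ^ 2 * d / lam = 16 * (lam * d) := by
    field_simp
  have h6 : 0 < lam * d := by positivity
  linarith
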